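/- Let G be a closed subgroup of O(N) such that for every x ∈ ℝ^N either Gx = {x} or Gx is infinite, and let 1 < p < N, p* := Np/(N−p). Let (u_k) be a sequence of measurable functions on ℝ^N such that |u_k| is G-invariant (|u_k(gx)| = |u_k(x)| for all g ∈ G and a.e. x) and sup_k ∫_{ℝ^N} |u_k|^{p*} < ∞. Let δ > 0, and let (ε_k) be a sequence in (0,∞) and (x_k) a sequence in ℝ^N such that ∫_{B_{ε_k}(x_k)} |u_k|^{p*} ≥ δ for all k. Then, after passing to a subsequence, there exist a constant C_1 > 0 and a sequence (ξ_k) of G-fixed points such that ∫_{B_{C_1 ε_k}(ξ_k)} |u_k|^{p*} ≥ δ for all k. -/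

import Mathlib

open MeasureTheory
open scoped ENNReal

noncomputable section

/-- `ℝ^N` with the Euclidean norm. -/
abbrev EucSp (N : ℕ) : Type := EuclideanSpace ℝ (Fin N)

/-- The orthogonal group `O(N)`. -/
abbrev ONgrp (N : ℕ) : Type := Matrix.orthogonalGroup (Fin N) ℝ

/-- Action of an orthogonal matrix on `ℝ^N`. -/
def oact {N : ℕ} (g : ONgrp N) (x : EucSp N) : EucSp N :=
  Matrix.toEuclideanLin (g : Matrix (Fin N) (Fin N) ℝ) x

/-- The `G`-orbit of a point `x ∈ ℝ^N`. -/
def orbitSet {N : ℕ} (G : Subgroup (ONgrp N)) (x : EucSp N) : Set (EucSp N) :=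
  {y | ∃ g ∈ G, oact g x = y}

/-- The critical Sobolev exponent `p* = Np/(N-p)`. -/
def pStar (N : ℕ) (p : ℝ) : ℝ := (N : ℝ) * p / ((N : ℝ) - p)

theorem oact_norm {N : ℕ} (g : ONgrp N) (x : EucSp N) : ‖oact g x‖ = ‖x‖ := by
  have h : (star (g : Matrix (Fin N) (Fin N) ℝ)) * g = 1 :=
    (Matrix.mem_orthogonalGroup_iff' (Fin N) ℝ).1 g.2
  have h2 : inner ℝ (oact g x) (oact g x) = inner ℝ x x := by
    unfold oact
    rw [← LinearMap.adjoint_inner_right, ← Matrix.toEuclideanLin_conjTranspose_eq_adjoint]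
    congr 1
    have h' : (g : Matrix (Fin N) (Fin N) ℝ).conjTranspose * g = 1 := h
    simp only [Matrix.toLpLin_apply, Matrix.mulVec_mulVec, h', Matrix.one_mulVec]
  rw [real_inner_self_eq_norm_sq, real_inner_self_eq_norm_sq] at h2
  exact (sq_eq_sq₀ (norm_nonneg _) (norm_nonneg _)).1 h2

def oactIso {N : ℕ} (g : ONgrp N) : EucSp N ≃ₗᵢ[ℝ] EucSp N :=
  LinearIsometry.toLinearIsometryEquiv
    ⟨Matrix.toEuclideanLin (g : Matrix (Fin N) (Fin N) ℝ), oact_norm g⟩ rfl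

theorem oactIso_apply {N : ℕ} (g : ONgrp N) (x : EucSp N) : oactIso g x = oact g x := rfl

def fixSub {N : ℕ} (G : Subgroup (ONgrp N)) : Submodule ℝ (EucSp N) where
  carrier := {x | ∀ g ∈ G, oact g x = x}
  add_mem' := by
    intro a b ha hb g hg
    rw [← oactIso_apply, map_add, oactIso_apply, oactIso_apply, ha g hg, hb g hg]
  zero_mem' := by
    intro g hg
    rw [← oactIso_apply, map_zero]
  smul_mem' := by
    intro c a ha g hg
    rw [← oactIso_apply, map_smul, oactIso_apply, ha g hg]

theorem exists_sep {N : ℕ} (G : Subgroup (ONgrp N))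
    (hS1 : ∀ x : EucSp N, orbitSet G x = {x} ∨ (orbitSet G x).Infinite) (m : ℕ) :
    ∃ c : ℝ, 0 < c ∧ ∀ w ∈ Metric.sphere (0 : EucSp N) 1 ∩ ((fixSub G)ᗮ : Set (EucSp N)),
      ∃ g : Fin m → ONgrp N, (∀ i, g i ∈ G) ∧
        ∀ i j, i ≠ j → c ≤ dist (oact (g i) w) (oact (g j) w) := by
  have hc : IsCompact (Metric.sphere (0 : EucSp N) 1 ∩ ((fixSub G)ᗮ : Set (EucSp N))) :=
    (isCompact_sphere _ _).inter_right (Submodule.isClosed_orthogonal _)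
  refine hc.induction_on (p := fun s => ∃ c : ℝ, 0 < c ∧ ∀ w ∈ s,
      ∃ g : Fin m → ONgrp N, (∀ i, g i ∈ G) ∧
        ∀ i j, i ≠ j → c ≤ dist (oact (g i) w) (oact (g j) w)) ?_ ?_ ?_ ?_
  · exact ⟨1, one_pos, by simp⟩
  · rintro s t hst ⟨c, hc, h⟩
    exact ⟨c, hc, fun w hw => h w (hst hw)⟩
  · rintro s t ⟨c, hc, h⟩ ⟨d, hd, h'⟩
    refine ⟨min c d, lt_min hc hd, ?_⟩
    rintro w (hw | hw)
    · obtain ⟨g, hg, hh⟩ := h w hw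
      exact ⟨g, hg, fun i j hij => (min_le_left _ _).trans (hh i j hij)⟩
    · obtain ⟨g, hg, hh⟩ := h' w hw
      exact ⟨g, hg, fun i j hij => (min_le_right _ _).trans (hh i j hij)⟩
  · rintro w ⟨hw1, hw2⟩
    have hinf : (orbitSet G w).Infinite := by
      refine (hS1 w).resolve_left fun h => ?_
      have hfix : w ∈ fixSub G := by
        intro g hg
        have : oact g w ∈ orbitSet G w := ⟨g, hg, rfl⟩
        rw [h] at this
        exact this
      have h0 : w = 0 := by
        have := Submodule.inner_right_of_mem_orthogonal hfix hw2
        exact inner_self_eq_zero.1 this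
      rw [h0] at hw1
      simp at hw1
    have := hinf.to_subtype
    obtain ⟨f⟩ : Nonempty (Fin m ↪ orbitSet G w) :=
      ⟨(Fin.valEmbedding).trans (Infinite.natEmbedding _)⟩
    choose g hg hgf using fun i => (f i).2
    have hpos : ∀ i j, i ≠ j → 0 < dist (oact (g i) w) (oact (g j) w) := by
      intro i j hij
      rw [hgf, hgf, dist_pos]
      exact fun h => hij (f.injective (Subtype.ext h))
    obtain ⟨c, hc, hcl⟩ : ∃ c : ℝ, 0 < c ∧ ∀ q : Fin m × Fin m, q.1 ≠ q.2 →
        c < dist (oact (g q.1) w) (oact (g q.2) w) := by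
      have : ∀ᶠ c in nhdsWithin (0:ℝ) (Set.Ioi 0), ∀ q : Fin m × Fin m, q.1 ≠ q.2 →
        c < dist (oact (g q.1) w) (oact (g q.2) w) := by
        rw [Filter.eventually_all]
        intro q
        by_cases hq : q.1 = q.2
        · simp [hq]
        · filter_upwards [nhdsWithin_le_nhds (eventually_lt_nhds (hpos _ _ hq))] with c hc _ using hc
      obtain ⟨c, h1, h2⟩ := (this.and self_mem_nhdsWithin).exists
      exact ⟨c, h2, h1⟩
    refine ⟨{v | ∀ q : Fin m × Fin m, q.1 ≠ q.2 →
        c < dist (oact (g q.1) v) (oact (g q.2) v)}, ?_, c, hc, ?_⟩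
    · apply nhdsWithin_le_nhds
      change ∀ᶠ v in nhds w, ∀ q : Fin m × Fin m, q.1 ≠ q.2 →
        c < dist (oact (g q.1) v) (oact (g q.2) v)
      rw [Filter.eventually_all]
      intro q
      by_cases hq : q.1 = q.2
      · simp [hq]
      · have hcont : Continuous fun v => dist (oact (g q.1) v) (oact (g q.2) v) :=
          (oactIso (g q.1)).continuous.dist (oactIso (g q.2)).continuous
        filter_upwards [hcont.continuousAt.eventually_const_lt (hcl q hq)] with v hv _ using hv
    · intro v hv
      exact ⟨g, hg, fun i j hij => (hv (i, j) hij).le⟩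

theorem ball_int {N : ℕ} (g : ONgrp N) (f : EucSp N → ℝ) (q : ℝ)
    (hinv : ∀ᵐ x : EucSp N ∂volume, |f (oact g x)| = |f x|) (x : EucSp N) (r : ℝ) :
    ∫⁻ y in Metric.ball (oact g x) r, ENNReal.ofReal (|f y| ^ q) =
      ∫⁻ y in Metric.ball x r, ENNReal.ofReal (|f y| ^ q) := by
  have hmp := (oactIso g).measurePreserving
  have hemb := (oactIso g).toHomeomorph.measurableEmbedding
  have h := hmp.setLIntegral_comp_preimage_emb hemb
    (fun y => ENNReal.ofReal (|f y| ^ q)) (Metric.ball (oact g x) r)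
  rw [← h, ← oactIso_apply, LinearIsometryEquiv.preimage_ball,
    LinearIsometryEquiv.symm_apply_apply]
  apply lintegral_congr_ae
  filter_upwards [ae_restrict_of_ae hinv] with y hy
  rw [oactIso_apply, hy]

/-- Concentration points of sequences with `G`-invariant modulus and
uniformly bounded critical norm can, after passing to a subsequence, be taken to be
`G`-fixed points (at the cost of enlarging the concentration radius by a fixed factor). -/
theorem concentration_at_fixed_points
    (N : ℕ) (G : Subgroup (ONgrp N)) (hGclosed : IsClosed (G : Set (ONgrp N)))
    (hS1 : ∀ x : EucSp N, orbitSet G x = {x} ∨ (orbitSet G x).Infinite)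
    (p : ℝ) (hp1 : 1 < p) (hpN : p < (N : ℝ))
    (u : ℕ → EucSp N → ℝ) (hmeas : ∀ k, Measurable (u k))
    (hinv : ∀ k, ∀ g ∈ G, ∀ᵐ x : EucSp N ∂volume, |u k (oact g x)| = |u k x|)
    (hbdd : ∃ C : ℝ≥0∞, C < ⊤ ∧
      ∀ k, (∫⁻ x : EucSp N, ENNReal.ofReal (|u k x| ^ pStar N p)) ≤ C)
    (δ : ℝ) (hδ : 0 < δ)
    (ε : ℕ → ℝ) (hε : ∀ k, 0 < ε k) (x : ℕ → EucSp N)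
    (hconc : ∀ k, ENNReal.ofReal δ ≤
      ∫⁻ y in Metric.ball (x k) (ε k), ENNReal.ofReal (|u k y| ^ pStar N p)) :
    ∃ σ : ℕ → ℕ, StrictMono σ ∧
      ∃ (C₁ : ℝ) (ξ : ℕ → EucSp N), 0 < C₁ ∧
        (∀ k, ∀ g ∈ G, oact g (ξ k) = ξ k) ∧
        (∀ k, ENNReal.ofReal δ ≤
          ∫⁻ y in Metric.ball (ξ k) (C₁ * ε (σ k)),
            ENNReal.ofReal (|u (σ k) y| ^ pStar N p)) := by
  obtain ⟨C, hC, hCb⟩ := hbdd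
  obtain ⟨m, hm⟩ := ENNReal.exists_nat_mul_gt (ENNReal.ofReal_pos.2 hδ).ne' hC.ne
  obtain ⟨c, hc, hsep⟩ := exists_sep G hS1 m
  refine ⟨id, strictMono_id, 2 / c + 1, fun k => (fixSub G).starProjection (x k), by positivity,
    fun k => Submodule.starProjection_apply_mem (fixSub G) (x k), fun k => ?_⟩
  refine (hconc k).trans (lintegral_mono_set (Metric.ball_subset_ball' ?_))
  set ξ := (fixSub G).starProjection (x k) with hξ
  suffices h : dist (x k) ξ ≤ 2 / c * ε k by simp only [id]; linarith
  by_contra! hlt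
  have hξm : ξ ∈ fixSub G := Submodule.starProjection_apply_mem (fixSub G) (x k)
  have hdpos : 0 < ‖x k - ξ‖ := by
    rw [← dist_eq_norm]
    exact lt_trans (by have := hε k; positivity) hlt
  have hy : x k - ξ ∈ (fixSub G)ᗮ := Submodule.sub_starProjection_mem_orthogonal (x k)
  obtain ⟨g, hg, hgs⟩ := hsep (‖x k - ξ‖⁻¹ • (x k - ξ))
    ⟨by simp [norm_smul, hdpos.ne'], Submodule.smul_mem _ _ hy⟩
  have hdist : ∀ i j, i ≠ j → 2 * ε k ≤ dist (oact (g i) (x k)) (oact (g j) (x k)) := by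
    intro i j hij
    have h := hgs i j hij
    have hx : ∀ i, oact (g i) (x k) = oact (g i) (x k - ξ) + ξ := by
      intro i
      rw [← oactIso_apply, ← oactIso_apply, map_sub, oactIso_apply _ ξ, hξm _ (hg i),
        sub_add_cancel]
    rw [hx i, hx j, dist_add_right]
    rw [← oactIso_apply, ← oactIso_apply, map_smul, map_smul, dist_smul₀, norm_inv, norm_norm,
      oactIso_apply, oactIso_apply, le_inv_mul_iff₀ hdpos] at h
    rw [dist_eq_norm, div_mul_eq_mul_div, div_lt_iff₀ hc] at hlt
    linarith
  have hdisj : Pairwise (Function.onFun Disjoint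
      fun i => Metric.ball (oact (g i) (x k)) (ε k)) := by
    intro i j hij
    apply Metric.ball_disjoint_ball
    linarith [hdist i j hij]
  have hsum : (m : ℝ≥0∞) * ENNReal.ofReal δ ≤ C := by
    calc (m : ℝ≥0∞) * ENNReal.ofReal δ
        = ∑ i : Fin m, ENNReal.ofReal δ := by simp
      _ ≤ ∑ i : Fin m, ∫⁻ y in Metric.ball (oact (g i) (x k)) (ε k),
            ENNReal.ofReal (|u k y| ^ pStar N p) := by
          refine Finset.sum_le_sum fun i _ => ?_
          rw [ball_int (g i) (u k) _ (hinv k _ (hg i))]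
          exact hconc k
      _ = ∫⁻ y in ⋃ i, Metric.ball (oact (g i) (x k)) (ε k),
            ENNReal.ofReal (|u k y| ^ pStar N p) := by
          rw [lintegral_iUnion (fun i => measurableSet_ball) hdisj, tsum_fintype]
      _ ≤ _ := setLIntegral_le_lintegral _ _
      _ ≤ C := hCb k
  exact absurd hsum (not_le.2 hm)
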